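/- For τ = 1 or τ = −1, the restriction map Ψ: ξ ↦ ξ|_{Q̃C} is a bijection from M_τ^0(QC) onto M_τ^0(Q̃C). -/

import Mathlib

open MeasureTheory Real Filter Topology

noncomputable section

/-- The `n`-th Fourier coefficient of `f : ℝ → ℂ` (representing `x ↦ f(e^{ix})`). -/
def fourierCoef (f : ℝ → ℂ) (n : ℤ) : ℂ :=
  (1 / (2 * π)) * ∫ x in (0 : ℝ)..(2 * π), f x * Complex.exp (-(Complex.I * n * x))

/-- `L^∞(T)`, modeled as bounded measurable `2π`-periodic functions `ℝ → ℂ`. -/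
def LinfT : Set (ℝ → ℂ) :=
  {f | Function.Periodic f (2 * π) ∧ Measurable f ∧ ∃ C, ∀ x, ‖f x‖ ≤ C}

/-- `C(T)`: continuous `2π`-periodic functions. -/
def CtsT : Set (ℝ → ℂ) := {f | Function.Periodic f (2 * π) ∧ Continuous f}

/-- The Hardy space `H^∞`: bounded functions whose negative Fourier coefficients vanish. -/
def HinfT : Set (ℝ → ℂ) := {f ∈ LinfT | ∀ n : ℤ, n < 0 → fourierCoef f n = 0}

/-- The conjugate Hardy space: bounded functions whose positive Fourier coefficients vanish. -/
def HinfBarT : Set (ℝ → ℂ) := {f ∈ LinfT | ∀ n : ℤ, 0 < n → fourierCoef f n = 0}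

/-- The quasicontinuous functions `QC = (C + H^∞) ∩ (C + conj(H^∞))`. -/
def QCset : Set (ℝ → ℂ) :=
  {f | (∃ c ∈ CtsT, ∃ h ∈ HinfT, f = c + h) ∧ (∃ c ∈ CtsT, ∃ h ∈ HinfBarT, f = c + h)}

/-- The flip `q̃(t) = q(1/t)`, i.e. `q̃(e^{ix}) = q(e^{-ix})`. -/
def flipF (f : ℝ → ℂ) : ℝ → ℂ := fun x => f (-x)

/-- The even quasicontinuous functions `Q̃C = {q ∈ QC : q = q̃}`. -/
def tQCset : Set (ℝ → ℂ) := {f ∈ QCset | flipF f = f}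

/-- The even continuous functions `C̃(T)`. -/
def evContT : Set (ℝ → ℂ) := {f ∈ CtsT | flipF f = f}

/-- The piecewise continuous functions `PC`: `2π`-periodic functions having one-sided
limits at every point. -/
def PCset : Set (ℝ → ℂ) :=
  {p | Function.Periodic p (2 * π) ∧
    ∀ θ : ℝ, (∃ l : ℂ, Tendsto p (𝓝[>] θ) (𝓝 l)) ∧ (∃ l : ℂ, Tendsto p (𝓝[<] θ) (𝓝 l))}

/-- `ξ` is a character (multiplicative linear functional of norm `1`) of the subalgebra of
`L^∞(T)` whose underlying set is `S`; only the values of `ξ` on `S` are relevant. -/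
def IsChar (S : Set (ℝ → ℂ)) (ξ : (ℝ → ℂ) → ℂ) : Prop :=
  (∀ p ∈ S, ∀ q ∈ S, ξ (p + q) = ξ p + ξ q) ∧
  (∀ p ∈ S, ∀ q ∈ S, ξ (p * q) = ξ p * ξ q) ∧
  (∀ (c : ℂ), ∀ q ∈ S, ξ (c • q) = c * ξ q) ∧
  ξ 1 = 1 ∧
  (∀ q ∈ S, ∀ C : ℝ, (∀ x, ‖q x‖ ≤ C) → ‖ξ q‖ ≤ C)

/-- The moving average `δ_{λ,τ}(a) = (λ/2π) ∫_{θ-π/λ}^{θ+π/λ} a(e^{ix}) dx`, `τ = e^{iθ}`. -/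
def movAvg (a : ℝ → ℂ) (lam θ : ℝ) : ℂ :=
  (lam / (2 * π)) * ∫ x in (θ - π / lam)..(θ + π / lam), a x

/-- `ξ ∈ M_τ^0(S)` (`τ = e^{iθ}`): `ξ` is a character of (the algebra with underlying set) `S`
lying in the weak-* closure of the moving-average functionals `{δ_{λ,τ} : λ ∈ [1,∞)}`. -/
def InM0 (S : Set (ℝ → ℂ)) (θ : ℝ) (ξ : (ℝ → ℂ) → ℂ) : Prop :=
  IsChar S ξ ∧
  ∀ qs : List (ℝ → ℂ), (∀ q ∈ qs, q ∈ S) → ∀ ε : ℝ, 0 < ε →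
    ∃ lam : ℝ, 1 ≤ lam ∧ ∀ q ∈ qs, ‖ξ q - movAvg q lam θ‖ < ε

/-- `ξ ∈ M_τ(S)` (`τ = e^{iθ}`): the fiber condition `ξ(f) = f(τ)` for all continuous `f`
belonging to `S`. -/
def InFiber (S : Set (ℝ → ℂ)) (θ : ℝ) (ξ : (ℝ → ℂ) → ℂ) : Prop :=
  IsChar S ξ ∧ ∀ f ∈ CtsT ∩ S, ξ f = f θ

/-- `ξ ∈ M_τ^+(QC)`: `ξ(f) = 0` whenever `limsup_{t→τ+0}|f(t)| = 0`, `f ∈ QC`. -/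
def InMplus (θ : ℝ) (ξ : (ℝ → ℂ) → ℂ) : Prop :=
  IsChar QCset ξ ∧
  ∀ f ∈ QCset, Filter.limsup (fun x => ‖f x‖) (𝓝[>] θ) = 0 → ξ f = 0

/-- `ξ ∈ M_τ^-(QC)`: `ξ(f) = 0` whenever `limsup_{t→τ-0}|f(t)| = 0`, `f ∈ QC`. -/
def InMminus (θ : ℝ) (ξ : (ℝ → ℂ) → ℂ) : Prop :=
  IsChar QCset ξ ∧
  ∀ f ∈ QCset, Filter.limsup (fun x => ‖f x‖) (𝓝[<] θ) = 0 → ξ f = 0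

/-- The conjugate character `ξ'(q) = ξ(q̃)`. -/
def conjChar (ξ : (ℝ → ℂ) → ℂ) : (ℝ → ℂ) → ℂ := fun q => ξ (flipF q)


lemma LinfT.intervalIntegrable {f : ℝ → ℂ} (hf : f ∈ LinfT) (a b : ℝ) :
    IntervalIntegrable f volume a b := by
  obtain ⟨-, hm, C, hC⟩ := hf
  exact (intervalIntegrable_const (c := C)).mono_fun hm.aestronglyMeasurable
    (ae_of_all _ fun x => (hC x).trans (le_abs_self C))

lemma LinfT.mul {f g : ℝ → ℂ} (hf : f ∈ LinfT) (hg : g ∈ LinfT) : f * g ∈ LinfT := by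
  obtain ⟨hp, hm, C, hC⟩ := hf
  obtain ⟨hp', hm', C', hC'⟩ := hg
  refine ⟨hp.mul hp', hm.mul hm', C * C', fun x => ?_⟩
  simp only [Pi.mul_apply, norm_mul]
  exact mul_le_mul (hC x) (hC' x) (norm_nonneg _) ((norm_nonneg _).trans (hC x))

lemma LinfT.add {f g : ℝ → ℂ} (hf : f ∈ LinfT) (hg : g ∈ LinfT) : f + g ∈ LinfT := by
  obtain ⟨hp, hm, C, hC⟩ := hf
  obtain ⟨hp', hm', C', hC'⟩ := hg
  exact ⟨hp.add hp', hm.add hm', C + C', fun x => (norm_add_le _ _).trans (add_le_add (hC x) (hC' x))⟩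

lemma LinfT.const (c : ℂ) : (fun _ => c : ℝ → ℂ) ∈ LinfT :=
  ⟨fun _ => rfl, measurable_const, ‖c‖, fun _ => le_rfl⟩

lemma LinfT.conj {f : ℝ → ℂ} (hf : f ∈ LinfT) : (fun x => (starRingEnd ℂ) (f x)) ∈ LinfT := by
  obtain ⟨hp, hm, C, hC⟩ := hf
  refine ⟨fun x => by simp only [hp x], Complex.continuous_conj.measurable.comp hm, C, fun x => ?_⟩
  simpa using hC x

lemma CtsT.mem_LinfT {f : ℝ → ℂ} (hf : f ∈ CtsT) : f ∈ LinfT := by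
  obtain ⟨hp, hc⟩ := hf
  refine ⟨hp, hc.measurable, ?_⟩
  have hb := hp.isBounded_of_continuous (by positivity) hc
  obtain ⟨C, hC⟩ := hb.exists_norm_le
  exact ⟨C, fun x => hC _ ⟨x, rfl⟩⟩

lemma QCset.mem_LinfT {f : ℝ → ℂ} (hf : f ∈ QCset) : f ∈ LinfT := by
  obtain ⟨⟨c, hc, h, hh, rfl⟩, -⟩ := hf
  exact LinfT.add (CtsT.mem_LinfT hc) hh.1

lemma ii_conj (f : ℝ → ℂ) (a b : ℝ) :
    ∫ x in a..b, (starRingEnd ℂ) (f x) = (starRingEnd ℂ) (∫ x in a..b, f x) := by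
  simp only [intervalIntegral, integral_conj, map_sub]

lemma fourierCoef_conj (f : ℝ → ℂ) (n : ℤ) :
    fourierCoef (fun x => (starRingEnd ℂ) (f x)) n = (starRingEnd ℂ) (fourierCoef f (-n)) := by
  simp only [fourierCoef, map_mul, ← ii_conj]
  congr 1
  · simp [Complex.conj_ofNat]
  · refine intervalIntegral.integral_congr fun x _ => ?_
    simp [← Complex.exp_conj]

lemma parseval_zero {f W : ℝ → ℂ} (hf : f ∈ LinfT) (hW : W ∈ LinfT)
    (h : ∀ n : ℤ, fourierCoef f (-n) = 0 ∨ fourierCoef W n = 0) :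
    ∫ x in (0 : ℝ)..(2 * π), f x * W x = 0 := by
  have hT : Fact (0 < 2 * π) := ⟨by positivity⟩
  have key : ∀ g ∈ LinfT, MemLp (AddCircle.liftIoc (2 * π) 0 g) 2 (AddCircle.haarAddCircle (T := 2 * π)) := by
    intro g hg
    rw [memLp_haarAddCircle_iff]
    apply MeasureTheory.MemLp.memLp_liftIoc
    obtain ⟨-, hm, C, hC⟩ := hg
    exact MemLp.of_bound hm.aestronglyMeasurable C (ae_of_all _ hC)
  have coef : ∀ g : ℝ → ℂ, ∀ n : ℤ, fourierCoeff (AddCircle.liftIoc (2 * π) 0 g) n = fourierCoef g n := by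
    intro g n
    rw [fourierCoeff_liftIoc_eq, fourierCoeffOn_eq_integral, fourierCoef]
    simp only [zero_add, sub_zero, Complex.real_smul]
    push_cast
    congr 1
    refine intervalIntegral.integral_congr fun x _ => ?_
    simp only [smul_eq_mul]
    rw [mul_comm, fourier_coe_apply]
    congr 2
    have : (π : ℂ) ≠ 0 := by exact_mod_cast Real.pi_ne_zero
    push_cast
    field_simp
    ring
  have hF := key _ (LinfT.conj hf)
  have hG := key _ hW
  have hs := (fourierBasis (T := 2 * π)).hasSum_inner_mul_inner (hF.toLp _) (hG.toLp _)
  have h0 : ∀ i, inner ℂ (hF.toLp _) (fourierBasis (T := 2 * π) i) *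
      inner ℂ (fourierBasis (T := 2 * π) i) (hG.toLp _) = 0 := by
    intro i
    rw [← inner_conj_symm, ← HilbertBasis.repr_apply_apply, ← HilbertBasis.repr_apply_apply,
      fourierBasis_repr, fourierBasis_repr, fourierCoeff_congr_ae hF.coeFn_toLp,
      fourierCoeff_congr_ae hG.coeFn_toLp, coef, coef]
    rw [fourierCoef_conj, Complex.conj_conj]
    rcases h i with h | h <;> simp [h]
  simp only [h0] at hs
  have hz := hs.unique hasSum_zero
  rw [L2.inner_def] at hz
  have e : ∫ a, inner ℂ ((hF.toLp _) a) ((hG.toLp _) a) ∂(AddCircle.haarAddCircle (T := 2 * π)) =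
    ∫ a, (AddCircle.liftIoc (2 * π) 0 (fun x => f x * W x)) a ∂(AddCircle.haarAddCircle (T := 2 * π)) := by
    refine integral_congr_ae ?_
    filter_upwards [hF.coeFn_toLp, hG.coeFn_toLp] with a h1 h2
    rw [h1, h2]
    simp [AddCircle.liftIoc, mul_comm]
  rw [e, AddCircle.integral_haarAddCircle, AddCircle.integral_liftIoc_eq_intervalIntegral] at hz
  simp only [zero_add, smul_eq_zero, inv_eq_zero] at hz
  rcases hz with hz | hz
  · exact absurd hz hT.out.ne'
  · exact hz

/-- Normalised Poisson kernel at the real point `z`. -/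
def Kz (z x : ℝ) : ℝ := (1 - z ^ 2) / (2 * π * (1 - 2 * z * Real.cos x + z ^ 2))

/-- Poisson average. -/
def PA (z : ℝ) (f : ℝ → ℂ) : ℂ := ∫ x in (0 : ℝ)..(2 * π), (Kz z x : ℂ) * f x

lemma Kden_pos {z : ℝ} (hz : |z| < 1) (x : ℝ) : 0 < 1 - 2 * z * Real.cos x + z ^ 2 := by
  have h1 := abs_lt.1 hz
  have h2 := Real.cos_le_one x
  have h3 := Real.neg_one_le_cos x
  rcases le_total 0 z with h | h <;> nlinarith

lemma Kz_mul_den {z : ℝ} (hz : |z| < 1) (x : ℝ) :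
    Kz z x * (1 - 2 * z * Real.cos x + z ^ 2) = (1 - z ^ 2) / (2 * π) := by
  have hd := (Kden_pos hz x).ne'
  have := Real.pi_ne_zero
  unfold Kz
  rw [← div_div]
  exact div_mul_cancel₀ _ hd

lemma Kz_nonneg {z : ℝ} (hz : |z| < 1) (x : ℝ) : 0 ≤ Kz z x := by
  have := Kden_pos hz x
  have h1 : z ^ 2 < 1 := (sq_lt_one_iff_abs_lt_one z).2 hz
  unfold Kz
  have := Real.pi_pos
  apply div_nonneg <;> [linarith; positivity]

lemma Kz_continuous {z : ℝ} (hz : |z| < 1) : Continuous (Kz z) := by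
  unfold Kz
  refine Continuous.div (by fun_prop) (by fun_prop) fun x => ?_
  have := Kden_pos hz x
  have := Real.pi_pos
  positivity

lemma Kz_cts {z : ℝ} (hz : |z| < 1) : (fun x => (Kz z x : ℂ)) ∈ CtsT := by
  refine ⟨fun x => ?_, Complex.continuous_ofReal.comp (Kz_continuous hz)⟩
  simp [Kz, Real.cos_add_two_pi]

lemma Kz_mem {z : ℝ} (hz : |z| < 1) : (fun x => (Kz z x : ℂ)) ∈ LinfT := CtsT.mem_LinfT (Kz_cts hz)

lemma PA_int {z : ℝ} (hz : |z| < 1) {f : ℝ → ℂ} (hf : f ∈ LinfT) (a b : ℝ) :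
    IntervalIntegrable (fun x => (Kz z x : ℂ) * f x) volume a b :=
  LinfT.intervalIntegrable (LinfT.mul (Kz_mem hz) hf) a b

/-- The function `e^{ix}`. -/
def Ex (x : ℝ) : ℂ := Complex.exp (Complex.I * x)

lemma Ex_cts : Ex ∈ CtsT := by
  refine ⟨fun x => ?_, by unfold Ex; fun_prop⟩
  unfold Ex
  rw [Complex.exp_eq_exp_iff_exists_int]
  exact ⟨1, by push_cast; ring⟩

lemma Ex_pow_mem (m : ℕ) : (fun x => Ex x ^ m) ∈ LinfT := by
  apply CtsT.mem_LinfT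
  exact ⟨fun x => by simp only [Ex_cts.1 x], Ex_cts.2.pow m⟩

lemma norm_Ex (x : ℝ) : ‖Ex x‖ = 1 := by
  unfold Ex; rw [mul_comm]; exact Complex.norm_exp_ofReal_mul_I x

lemma Ex_sq (x : ℝ) : Ex x ^ 2 + 1 = 2 * Real.cos x * Ex x := by
  have h : Ex x = Real.cos x + Real.sin x * Complex.I := by
    unfold Ex; rw [mul_comm, Complex.exp_mul_I]; push_cast; rfl
  rw [h]
  have h2 : (Real.sin x : ℂ) ^ 2 = 1 - (Real.cos x : ℂ) ^ 2 := by
    have := Real.sin_sq_add_cos_sq x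
    exact_mod_cast eq_sub_of_add_eq this
  have h3 : Complex.I ^ 2 = -1 := Complex.I_sq
  linear_combination (Complex.I ^ 2) * h2 + (1 - (Real.cos x : ℂ) ^ 2) * h3

lemma PA_Ex_rec {z : ℝ} (hz : |z| < 1) {G : ℝ → ℂ} (hG : G ∈ LinfT)
    (h0 : ∀ m : ℕ, ∫ x in (0 : ℝ)..(2 * π), G x * Ex x ^ (m + 1) = 0) (m : ℕ) :
    PA z (G * fun x => Ex x ^ (m + 1)) = z * PA z (G * fun x => Ex x ^ m) := by
  set a : ℕ → ℂ := fun m => PA z (G * fun x => Ex x ^ m) with ha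
  have hmem : ∀ m, (G * fun x => Ex x ^ m) ∈ LinfT := fun m => LinfT.mul hG (Ex_pow_mem m)
  have hrec : ∀ m, (1 + (z : ℂ) ^ 2) * a (m + 1) - z * a (m + 2) - z * a m = 0 := by
    intro m
    have hI := fun m => PA_int hz (hmem m) 0 (2 * π)
    simp only [ha, PA]
    rw [← intervalIntegral.integral_const_mul, ← intervalIntegral.integral_const_mul,
      ← intervalIntegral.integral_const_mul, ← intervalIntegral.integral_sub
        ((hI _).const_mul _) ((hI _).const_mul _), ← intervalIntegral.integral_sub
        (((hI _).const_mul _).sub ((hI _).const_mul _)) ((hI _).const_mul _)]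
    have := h0 m
    have this' := congrArg (fun w => ((1 - (z : ℂ) ^ 2) / (2 * π)) * w) this
    simp only [mul_zero] at this'
    rw [← this', ← intervalIntegral.integral_const_mul]
    refine intervalIntegral.integral_congr fun x _ => ?_
    have hd := (Kden_pos hz x).ne'
    have hd' : (1 - 2 * (z : ℂ) * Real.cos x + (z : ℂ) ^ 2) ≠ 0 := by exact_mod_cast hd
    have hp : (π : ℂ) ≠ 0 := by exact_mod_cast Real.pi_ne_zero
    have hK : (Kz z x : ℂ) * (1 - 2 * (z : ℂ) * Real.cos x + (z : ℂ) ^ 2) = (1 - (z : ℂ) ^ 2) / (2 * π) := by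
      exact_mod_cast congrArg Complex.ofReal (Kz_mul_den hz x)
    simp only [Pi.mul_apply]
    rw [← hK]
    have hE := Ex_sq x
    linear_combination (-(z : ℂ) * (Kz z x : ℂ) * G x * Ex x ^ m) * hE
  have hb : ∀ m, a (m + 1) - z * a m = z * (a (m + 2) - z * a (m + 1)) := by
    intro m; linear_combination hrec m
  have hb2 : ∀ k, a (m + 1) - z * a m = z ^ k * (a (m + k + 1) - z * a (m + k)) := by
    intro k
    induction k with
    | zero => simp
    | succ k ih =>
      rw [ih, hb (m + k)]
      ring_nf
  obtain ⟨B, hB⟩ : ∃ B, ∀ m, ‖a m‖ ≤ B := by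
    obtain ⟨-, -, C, hC⟩ := LinfT.mul (Kz_mem hz) hG
    refine ⟨C * |2 * π - 0|, fun m => intervalIntegral.norm_integral_le_of_norm_le_const fun x _ => ?_⟩
    simpa [norm_Ex] using hC x
  have hB2 : ∀ k, ‖a (m + 1) - z * a m‖ ≤ |z| ^ k * (B + B) := by
    intro k
    rw [hb2 k, norm_mul, norm_pow, Complex.norm_real, Real.norm_eq_abs]
    gcongr
    refine (norm_sub_le _ _).trans (add_le_add (hB _) ?_)
    rw [norm_mul, Complex.norm_real, Real.norm_eq_abs]
    have := hB (m + k)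
    nlinarith [norm_nonneg (a (m + k)), abs_nonneg z]
  have hl : Tendsto (fun k : ℕ => |z| ^ k * (B + B)) atTop (𝓝 0) := by
    simpa using (tendsto_pow_atTop_nhds_zero_of_lt_one (abs_nonneg z) hz).mul_const (B + B)
  have := ge_of_tendsto' hl hB2
  have := norm_le_zero_iff.1 this
  exact sub_eq_zero.1 this

lemma integral_Ex_pow (m : ℕ) : ∫ x in (0 : ℝ)..(2 * π), Ex x ^ (m + 1) = 0 := by
  have h : ∀ x : ℝ, Ex x ^ (m + 1) = Complex.exp (((m + 1 : ℕ) : ℂ) * Complex.I * x) := by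
    intro x; unfold Ex; rw [← Complex.exp_nat_mul]; ring_nf
  simp only [h]
  rw [integral_exp_mul_complex]
  · have : Complex.exp (((m + 1 : ℕ) : ℂ) * Complex.I * ((2 * π : ℝ) : ℂ)) = 1 := by
      rw [Complex.exp_eq_one_iff]
      exact ⟨(m + 1 : ℕ), by push_cast; ring⟩
    rw [this]; simp
  · simp [Complex.I_ne_zero]
    exact_mod_cast Nat.succ_ne_zero m

lemma Kz_int {z : ℝ} (hz : |z| < 1) : ∫ x in (0 : ℝ)..(2 * π), Kz z x = 1 ∧
    ∫ x in (0 : ℝ)..(2 * π), Kz z x * Real.cos x = z := by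
  have h := PA_Ex_rec hz (G := fun _ => 1) (LinfT.const 1) (fun m => by simpa using integral_Ex_pow m) 0
  have hc := Kz_continuous hz
  have h1 : ∫ x in (0 : ℝ)..(2 * π), Kz z x * Real.cos x = z * ∫ x in (0 : ℝ)..(2 * π), Kz z x := by
    have h' := congrArg Complex.re h
    simp only [PA, Pi.mul_apply, zero_add, pow_one, pow_zero, mul_one, one_mul,
      intervalIntegral.integral_ofReal, ← Complex.ofReal_mul, Complex.ofReal_re] at h'
    rw [← h', ← Complex.reCLM_apply, ← ContinuousLinearMap.intervalIntegral_comp_comm]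
    · refine intervalIntegral.integral_congr fun x _ => ?_
      simp [Ex, mul_comm Complex.I, Complex.exp_ofReal_mul_I_re]
    · have := PA_int hz (Ex_pow_mem 1) 0 (2 * π)
      simpa using this
  have h2 : (1 + z ^ 2) * (∫ x in (0 : ℝ)..(2 * π), Kz z x) -
      2 * z * ∫ x in (0 : ℝ)..(2 * π), Kz z x * Real.cos x = 1 - z ^ 2 := by
    rw [← intervalIntegral.integral_const_mul, ← intervalIntegral.integral_const_mul,
      ← intervalIntegral.integral_sub
       (Continuous.intervalIntegrable (by fun_prop) _ _) (Continuous.intervalIntegrable (by fun_prop) _ _)]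
    have : ∀ x, (1 + z ^ 2) * Kz z x - 2 * z * (Kz z x * Real.cos x) = (1 - z ^ 2) / (2 * π) := by
      intro x
      have hd := (Kden_pos hz x).ne'
      have := Real.pi_ne_zero
      rw [← Kz_mul_den hz x]
      ring
    simp only [this]
    rw [intervalIntegral.integral_const]
    have := Real.pi_ne_zero
    simp only [sub_zero, smul_eq_mul]
    field_simp
  have hz2 : z ^ 2 < 1 := (sq_lt_one_iff_abs_lt_one z).2 hz
  have h3 : (1 - z ^ 2) * (∫ x in (0 : ℝ)..(2 * π), Kz z x) = (1 - z ^ 2) * 1 := by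
    rw [h1] at h2; linarith
  have h4 := mul_left_cancel₀ (by linarith : (1 - z ^ 2) ≠ 0) h3
  exact ⟨h4, by rw [h1, h4, mul_one]⟩

lemma PA_add {z : ℝ} (hz : |z| < 1) {f g : ℝ → ℂ} (hf : f ∈ LinfT) (hg : g ∈ LinfT) :
    PA z (f + g) = PA z f + PA z g := by
  unfold PA
  rw [← intervalIntegral.integral_add (PA_int hz hf _ _) (PA_int hz hg _ _)]
  simp only [Pi.add_apply, mul_add]

lemma PA_const_mul (z : ℝ) (c : ℂ) (f : ℝ → ℂ) :
    PA z ((fun _ => c) * f) = c * PA z f := by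
  unfold PA
  rw [← intervalIntegral.integral_const_mul]
  refine intervalIntegral.integral_congr fun x _ => ?_
  simp only [Pi.mul_apply]; ring

lemma PA_const {z : ℝ} (hz : |z| < 1) (c : ℂ) : PA z (fun _ => c) = c := by
  unfold PA
  rw [intervalIntegral.integral_mul_const, intervalIntegral.integral_ofReal, (Kz_int hz).1]
  simp

lemma PA_conj (z : ℝ) (f : ℝ → ℂ) :
    PA z (fun x => (starRingEnd ℂ) (f x)) = (starRingEnd ℂ) (PA z f) := by
  unfold PA
  rw [← ii_conj]
  simp

lemma fourierCoef_neg_eq (f : ℝ → ℂ) (m : ℕ) :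
    fourierCoef f (-(m : ℤ)) = (1 / (2 * π)) * ∫ x in (0 : ℝ)..(2 * π), f x * Ex x ^ m := by
  unfold fourierCoef
  congr 1
  refine intervalIntegral.integral_congr fun x _ => ?_
  simp only [Ex, ← Complex.exp_nat_mul]
  congr 2
  push_cast
  ring

lemma fourierCoef_neg_zero_iff (f : ℝ → ℂ) (m : ℕ) :
    fourierCoef f (-(m : ℤ)) = 0 ↔ ∫ x in (0 : ℝ)..(2 * π), f x * Ex x ^ m = 0 := by
  rw [fourierCoef_neg_eq]
  have hp : (π : ℂ) ≠ 0 := by exact_mod_cast Real.pi_ne_zero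
  simp [hp]

lemma Hinf_int {f : ℝ → ℂ} (hf : f ∈ HinfT) (m : ℕ) :
    ∫ x in (0 : ℝ)..(2 * π), f x * Ex x ^ (m + 1) = 0 := by
  rw [← fourierCoef_neg_zero_iff]
  exact hf.2 _ (by push_cast; omega)

lemma PA_mul_H {z : ℝ} (hz : |z| < 1) {f g : ℝ → ℂ} (hf : f ∈ HinfT) (hg : g ∈ HinfT) :
    PA z (f * g) = PA z f * PA z g := by
  set c := PA z g with hc
  set G : ℝ → ℂ := g + fun _ => -c with hG
  have hGm : G ∈ LinfT := LinfT.add hg.1 (LinfT.const _)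
  have hG0 : PA z G = 0 := by
    rw [hG, PA_add hz hg.1 (LinfT.const _), PA_const hz]; simp [hc]
  have hrec := PA_Ex_rec hz hGm (fun m => by
    have h1 := Hinf_int hg m
    have h2 := integral_Ex_pow m
    have e : ∀ x, G x * Ex x ^ (m + 1) = g x * Ex x ^ (m + 1) + (-c) * Ex x ^ (m + 1) := by
      intro x; simp only [hG, Pi.add_apply]; ring
    simp only [e]
    rw [intervalIntegral.integral_add, intervalIntegral.integral_const_mul, h1, h2]
    · simp
    · exact LinfT.intervalIntegrable (LinfT.mul hg.1 (Ex_pow_mem _)) _ _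
    · exact (LinfT.intervalIntegrable (Ex_pow_mem _) _ _).const_mul _)
  have hall : ∀ m : ℕ, PA z (G * fun x => Ex x ^ m) = 0 := by
    intro m
    induction m with
    | zero => simpa [PA] using hG0
    | succ m ih => rw [hrec m, ih, mul_zero]
  have hWm : (fun x => (Kz z x : ℂ)) * G ∈ LinfT := LinfT.mul (Kz_mem hz) hGm
  have hpar := parseval_zero hf.1 hWm (by
    intro n
    rcases lt_or_ge 0 n with hn | hn
    · left; exact hf.2 _ (by omega)
    · right
      obtain ⟨m, rfl⟩ : ∃ m : ℕ, n = -(m : ℤ) := ⟨n.natAbs, by omega⟩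
      rw [fourierCoef_neg_zero_iff, ← hall m]
      unfold PA
      refine intervalIntegral.integral_congr fun x _ => ?_
      simp only [Pi.mul_apply]; ring)
  have h1 : PA z (f * G) = 0 := by
    rw [← hpar]
    unfold PA
    refine intervalIntegral.integral_congr fun x _ => ?_
    simp only [Pi.mul_apply]; ring
  have h2 : f * G = f * g + (fun _ => -c) * f := by
    ext x; simp only [hG, Pi.mul_apply, Pi.add_apply]; ring
  rw [h2, PA_add hz (LinfT.mul hf.1 hg.1) (LinfT.mul (LinfT.const _) hf.1), PA_const_mul] at h1
  linear_combination h1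

/-- Multiplicativity defect. -/
def DD (z : ℝ) (f g : ℝ → ℂ) : ℂ := PA z (f * g) - PA z f * PA z g

lemma DD_comm (z : ℝ) (f g : ℝ → ℂ) : DD z f g = DD z g f := by
  unfold DD; rw [mul_comm f g, mul_comm (PA z f)]

lemma DD_add {z : ℝ} (hz : |z| < 1) {f g h : ℝ → ℂ} (hf : f ∈ LinfT) (hg : g ∈ LinfT) (hh : h ∈ LinfT) :
    DD z (f + g) h = DD z f h + DD z g h := by
  unfold DD
  rw [add_mul, PA_add hz (LinfT.mul hf hh) (LinfT.mul hg hh), PA_add hz hf hg]; ring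

lemma PA_norm_le {z : ℝ} (hz : |z| < 1) {f : ℝ → ℂ} {g : ℝ → ℝ} (hg : Continuous g)
    (hfg : ∀ x, ‖f x‖ ≤ g x) : ‖PA z f‖ ≤ ∫ x in (0 : ℝ)..(2 * π), Kz z x * g x := by
  have hc := Kz_continuous hz
  refine intervalIntegral.norm_integral_le_of_norm_le (by positivity) (ae_of_all _ fun x _ => ?_)
    (Continuous.intervalIntegrable (by fun_prop) _ _)
  rw [norm_mul, Complex.norm_real, Real.norm_of_nonneg (Kz_nonneg hz x)]
  exact mul_le_mul_of_nonneg_left (hfg x) (Kz_nonneg hz x)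

/-- A continuous periodic function is close to its value at `θ` up to a multiple of `1 - cos`. -/
lemma cts_bound {c : ℝ → ℂ} (hc : c ∈ CtsT) (θ : ℝ) {ε : ℝ} (hε : 0 < ε) :
    ∃ M : ℝ, 0 ≤ M ∧ ∀ x, ‖c x - c θ‖ ≤ ε + M * (1 - Real.cos (x - θ)) := by
  obtain ⟨hp, hcont⟩ := hc
  obtain ⟨-, -, C, hC⟩ := CtsT.mem_LinfT ⟨hp, hcont⟩
  obtain ⟨δ, hδ, hδc⟩ := Metric.continuous_iff.1 hcont θ ε hε
  set δ' := min δ π with hδ'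
  have hδ'0 : 0 < δ' := lt_min hδ Real.pi_pos
  have hδ'π : δ' ≤ π := min_le_right _ _
  have hcos : Real.cos δ' < 1 := by
    rw [← Real.cos_zero]
    exact Real.cos_lt_cos_of_nonneg_of_le_pi le_rfl hδ'π hδ'0
  have hC0 : 0 ≤ C := (norm_nonneg _).trans (hC 0)
  have hper : Function.Periodic (fun x => ‖c x - c θ‖ - (ε + 2 * C / (1 - Real.cos δ') * (1 - Real.cos (x - θ)))) (2 * π) := by
    intro x
    simp only [hp x]
    rw [show x + 2 * π - θ = (x - θ) + 2 * π by ring, Real.cos_add_two_pi]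
  have h1 : 0 < 1 - Real.cos δ' := by linarith
  refine ⟨2 * C / (1 - Real.cos δ'), by positivity, fun x => ?_⟩
  rw [← sub_nonpos]
  obtain ⟨y, hy, hxy⟩ := hper.exists_mem_Ico (by positivity) x (θ - π)
  rw [hxy]
  by_cases hyd : |y - θ| < δ'
  · have := hδc y (lt_of_lt_of_le (by rw [Real.dist_eq]; exact hyd) (min_le_left _ _))
    rw [dist_eq_norm] at this
    have : 0 ≤ 2 * C / (1 - Real.cos δ') * (1 - Real.cos (y - θ)) :=
      mul_nonneg (by positivity) (by linarith [Real.cos_le_one (y - θ)])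
    linarith
  · push Not at hyd
    have habs : |y - θ| ≤ π := abs_le.2 ⟨by linarith [hy.1], by linarith [hy.2]⟩
    have : Real.cos (y - θ) ≤ Real.cos δ' := by
      rw [← Real.cos_abs (y - θ)]
      exact Real.cos_le_cos_of_nonneg_of_le_pi hδ'0.le habs hyd
    have h2 : 2 * C ≤ 2 * C / (1 - Real.cos δ') * (1 - Real.cos (y - θ)) := by
      rw [div_mul_eq_mul_div, le_div_iff₀ h1]
      exact mul_le_mul_of_nonneg_left (by linarith) (by linarith)
    have h3 : ‖c y - c θ‖ ≤ 2 * C := (norm_sub_le _ _).trans (by linarith [hC y, hC θ])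
    linarith

lemma DD_const {z : ℝ} (hz : |z| < 1) (c : ℂ) (g : ℝ → ℂ) : DD z (fun _ => c) g = 0 := by
  unfold DD; rw [PA_const_mul, PA_const hz, sub_self]

lemma DD_cts {θ s : ℝ} (hs : s ^ 2 = 1) (hcos : ∀ x, s * Real.cos x = Real.cos (x - θ))
    {c g : ℝ → ℂ} (hc : c ∈ CtsT) (hg : g ∈ LinfT) :
    Tendsto (fun r : ℝ => DD (s * r) c g) (𝓝[<] 1) (𝓝 0) := by
  obtain ⟨-, -, C, hC⟩ := id hg
  have hC0 : 0 ≤ C := (norm_nonneg _).trans (hC 0)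
  have key : ∀ ε > 0, ∃ M, ∀ r : ℝ, |r| < 1 → ‖DD (s * r) c g‖ ≤ 2 * C * (ε + M * (1 - r)) := by
    intro ε hε
    obtain ⟨M, hM, hb⟩ := cts_bound hc θ hε
    refine ⟨M, fun r hr => ?_⟩
    have hs' : |s| = 1 := (pow_eq_one_iff_of_nonneg (abs_nonneg s) two_ne_zero).1 (by rw [sq_abs, hs])
    have hz : |s * r| < 1 := by rw [abs_mul, hs', one_mul]; exact hr
    set u : ℝ → ℂ := c + fun _ => -c θ with hu
    have hum : u ∈ LinfT := LinfT.add (CtsT.mem_LinfT hc) (LinfT.const _)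
    have hD : DD (s * r) c g = DD (s * r) u g := by
      rw [hu, DD_add hz (CtsT.mem_LinfT hc) (LinfT.const _) hg, DD_const hz, add_zero]
    have hub : ∀ x, ‖u x‖ ≤ ε + M * (1 - s * Real.cos x) := by
      intro x; rw [hcos]; simpa [hu, sub_eq_add_neg] using hb x
    have hKc := Kz_continuous hz
    have hI : ∫ x in (0 : ℝ)..(2 * π), Kz (s * r) x * (ε + M * (1 - s * Real.cos x)) =
        ε + M * (1 - r) := by
      have e : ∀ x, Kz (s * r) x * (ε + M * (1 - s * Real.cos x)) =
        (ε + M) * Kz (s * r) x - M * s * (Kz (s * r) x * Real.cos x) := by intro x; ring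
      simp only [e]
      rw [intervalIntegral.integral_sub (Continuous.intervalIntegrable (by fun_prop) _ _)
        (Continuous.intervalIntegrable (by fun_prop) _ _), intervalIntegral.integral_const_mul,
        intervalIntegral.integral_const_mul, (Kz_int hz).1, (Kz_int hz).2]
      linear_combination (-M * r) * hs
    have h1 : ‖PA (s * r) u‖ ≤ ε + M * (1 - r) :=
      hI ▸ PA_norm_le hz (by fun_prop) hub
    have h2 : ‖PA (s * r) (u * g)‖ ≤ C * (ε + M * (1 - r)) := by
      have := PA_norm_le hz (f := u * g) (g := fun x => C * (ε + M * (1 - s * Real.cos x))) (by fun_prop)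
        (fun x => by
          simp only [Pi.mul_apply, norm_mul]
          rw [mul_comm]
          exact mul_le_mul (hC x) (hub x) (norm_nonneg _) hC0)
      refine this.trans (le_of_eq ?_)
      rw [← hI, ← intervalIntegral.integral_const_mul]
      refine intervalIntegral.integral_congr fun x _ => ?_
      ring
    have h3 : ‖PA (s * r) g‖ ≤ C := by
      have := PA_norm_le hz (f := g) (g := fun x => C) (by fun_prop) hC
      rwa [intervalIntegral.integral_mul_const, (Kz_int hz).1, one_mul] at this
    rw [hD]
    unfold DD
    refine (norm_sub_le _ _).trans ?_
    rw [norm_mul]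
    have := mul_le_mul h1 h3 (norm_nonneg _) ((norm_nonneg _).trans h1)
    linarith
  rw [Metric.tendsto_nhds]
  intro ε hε
  obtain ⟨M, hM⟩ := key (ε / (4 * (C + 1))) (by positivity)
  have hlim : Tendsto (fun r : ℝ => 2 * C * (ε / (4 * (C + 1)) + M * (1 - r))) (𝓝[<] 1)
      (𝓝 (2 * C * (ε / (4 * (C + 1)) + M * (1 - 1)))) :=
    (Continuous.tendsto (by fun_prop) 1).mono_left nhdsWithin_le_nhds
  have hlt : 2 * C * (ε / (4 * (C + 1)) + M * (1 - 1)) < ε := by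
    rw [sub_self, mul_zero, add_zero, ← mul_div_assoc, div_lt_iff₀ (by positivity)]
    nlinarith
  have hpos : ∀ᶠ r : ℝ in 𝓝[<] 1, 0 < r :=
    nhdsWithin_le_nhds (lt_mem_nhds one_pos)
  filter_upwards [hlim.eventually_lt_const hlt, self_mem_nhdsWithin, hpos] with r h1 h2 h3
  rw [dist_zero_right]
  exact (hM r (abs_lt.2 ⟨by linarith, h2⟩)).trans_lt h1

lemma DD_QC {θ s : ℝ} (hs : s ^ 2 = 1) (hcos : ∀ x, s * Real.cos x = Real.cos (x - θ))
    {p : ℝ → ℂ} (hp : p ∈ QCset) :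
    Tendsto (fun r : ℝ => DD (s * r) p (fun x => (starRingEnd ℂ) (p x))) (𝓝[<] 1) (𝓝 0) := by
  have hpL := QCset.mem_LinfT hp
  obtain ⟨⟨c1, hc1, h1, hh1, e1⟩, ⟨c2, hc2, h2, hh2, e2⟩⟩ := hp
  set c3 : ℝ → ℂ := fun x => (starRingEnd ℂ) (c2 x)
  set h3 : ℝ → ℂ := fun x => (starRingEnd ℂ) (h2 x)
  have hc3 : c3 ∈ CtsT := ⟨fun x => by simp only [c3, hc2.1 x], Complex.continuous_conj.comp hc2.2⟩
  have hh3 : h3 ∈ HinfT := ⟨LinfT.conj hh2.1, fun n hn => by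
    simp only [h3, fourierCoef_conj]; rw [hh2.2 _ (by omega), map_zero]⟩
  have e3 : (fun x => (starRingEnd ℂ) (p x)) = c3 + h3 := by
    ext x; simp [e2, c3, h3]
  have T1 := DD_cts hs hcos hc1 (LinfT.conj hpL)
  have T2 := DD_cts hs hcos hc3 hh1.1
  have T := T1.add T2
  rw [add_zero] at T
  refine T.congr' ?_
  have hpos : ∀ᶠ r : ℝ in 𝓝[<] 1, 0 < r :=
    nhdsWithin_le_nhds (lt_mem_nhds one_pos)
  filter_upwards [self_mem_nhdsWithin, hpos] with r h2 h3'
  have hs' : |s| = 1 := (pow_eq_one_iff_of_nonneg (abs_nonneg s) two_ne_zero).1 (by rw [sq_abs, hs])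
  have hz : |s * r| < 1 := by
    rw [abs_mul, hs', one_mul]; exact abs_lt.2 ⟨by linarith, h2⟩
  have hc1L := CtsT.mem_LinfT hc1
  have hc3L := CtsT.mem_LinfT hc3
  have E1 : DD (s * r) p (fun x => (starRingEnd ℂ) (p x)) = DD (s * r) c1 (fun x => (starRingEnd ℂ) (p x))
      + DD (s * r) h1 (fun x => (starRingEnd ℂ) (p x)) := by
    rw [← DD_add hz hc1L hh1.1 (LinfT.conj hpL), ← e1]
  have E2 : DD (s * r) h1 (fun x => (starRingEnd ℂ) (p x)) = DD (s * r) c3 h1 := by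
    rw [e3, DD_comm, DD_add hz hc3L hh3.1 hh1.1]
    have : DD (s * r) h3 h1 = 0 := by unfold DD; rw [PA_mul_H hz hh3 hh1, sub_self]
    rw [this, add_zero]
  rw [E1, E2]

lemma Kz_lower {θ s : ℝ} (hs : s ^ 2 = 1) (hcos : ∀ x, s * Real.cos x = Real.cos (x - θ))
    {lam : ℝ} (hl : 2 ≤ lam) {x : ℝ} (hx : |x - θ| ≤ π / lam) :
    lam / (2 * π) ≤ 11 * Kz (s * (1 - 1 / lam)) x := by
  have hl0 : 0 < lam := by linarith
  set t := 1 / lam with ht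
  have ht0 : 0 < t := by positivity
  have ht2 : t ≤ 1 / 2 := one_div_le_one_div_of_le two_pos hl
  have hlt : lam * t = 1 := by rw [ht]; field_simp
  have hK : Kz (s * (1 - t)) x =
      (1 - (1 - t) ^ 2) / (2 * π * (1 - 2 * (1 - t) * Real.cos (x - θ) + (1 - t) ^ 2)) := by
    unfold Kz; rw [← hcos, mul_pow, hs]; ring_nf
  rw [hK]
  set D := 1 - 2 * (1 - t) * Real.cos (x - θ) + (1 - t) ^ 2 with hD
  have hcos1 := Real.one_sub_sq_div_two_le_cos (x := x - θ)
  have hcos2 := Real.cos_le_one (x - θ)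
  have hx2 : (x - θ) ^ 2 ≤ 10 * t ^ 2 := by
    have h1 : |x - θ| ≤ π * t := by rw [ht, mul_one_div]; exact hx
    have h2 : (x - θ) ^ 2 ≤ (π * t) ^ 2 := by
      rw [← sq_abs (x - θ)]; exact pow_le_pow_left₀ (abs_nonneg _) h1 2
    have h3 : π ^ 2 ≤ 10 := by nlinarith [Real.pi_lt_d2, Real.pi_pos]
    nlinarith [sq_nonneg t]
  have hD1 : D ≤ 11 * t ^ 2 := by rw [hD]; nlinarith
  have hD0 : 0 < D := by rw [hD]; nlinarith [pow_pos ht0 2]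
  have hp := Real.pi_pos
  rw [← mul_div_assoc, div_le_div_iff₀ (by positivity) (by positivity)]
  have h5 : lam * D ≤ 11 * t := by
    calc lam * D ≤ lam * (11 * t ^ 2) := mul_le_mul_of_nonneg_left hD1 hl0.le
      _ = 11 * t * (lam * t) := by ring
      _ = 11 * t := by rw [hlt, mul_one]
  have h6 : t ≤ 1 - (1 - t) ^ 2 := by nlinarith
  have h7 : lam * D ≤ 11 * (1 - (1 - t) ^ 2) := by linarith
  nlinarith [mul_le_mul_of_nonneg_right h7 (by positivity : 0 ≤ 2 * π)]

lemma avg_le_Kz {θ s : ℝ} (hs : s ^ 2 = 1) (hcos : ∀ x, s * Real.cos x = Real.cos (x - θ))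
    {lam : ℝ} (hl : 2 ≤ lam) {g : ℝ → ℝ} (hg0 : ∀ x, 0 ≤ g x) (hgp : Function.Periodic g (2 * π))
    (hgm : Measurable g) (hgb : ∃ C, ∀ x, g x ≤ C) :
    lam / (2 * π) * ∫ x in (θ - π / lam)..(θ + π / lam), g x ≤
      11 * ∫ x in (0 : ℝ)..(2 * π), Kz (s * (1 - 1 / lam)) x * g x := by
  have hl0 : 0 < lam := by linarith
  have ht0 : 0 < 1 / lam := by positivity
  have ht2 : 1 / lam ≤ 1 / 2 := one_div_le_one_div_of_le two_pos hl
  have hs' : |s| = 1 := (pow_eq_one_iff_of_nonneg (abs_nonneg s) two_ne_zero).1 (by rw [sq_abs, hs])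
  have hz : |s * (1 - 1 / lam)| < 1 := by
    rw [abs_mul, hs', one_mul]; exact abs_lt.2 ⟨by linarith, by linarith⟩
  set z := s * (1 - 1 / lam) with hzd
  obtain ⟨C, hC⟩ := hgb
  have hKc := Kz_continuous hz
  have hint : ∀ a b, IntervalIntegrable g volume a b := fun a b =>
    (intervalIntegrable_const (c := C)).mono_fun hgm.aestronglyMeasurable
      (ae_of_all _ fun x => by
        show ‖g x‖ ≤ ‖C‖
        rw [Real.norm_of_nonneg (hg0 x)]; exact (hC x).trans (le_abs_self C))
  have hint2 : ∀ a b, IntervalIntegrable (fun x => Kz z x * g x) volume a b := fun a b =>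
    (hint a b).continuousOn_mul hKc.continuousOn
  have hper : Function.Periodic (fun x => Kz z x * g x) (2 * π) := by
    intro x; simp only [hgp x, Kz, Real.cos_add_two_pi]
  have e := hper.intervalIntegral_add_eq 0 (θ - π)
  rw [zero_add] at e
  have hp := Real.pi_pos
  have hpl : π / lam ≤ π := div_le_self hp.le (by linarith)
  have hpl0 : 0 < π / lam := by positivity
  have m1 : ∫ x in (θ - π / lam)..(θ + π / lam), Kz z x * g x ≤
      ∫ x in (θ - π)..(θ - π + 2 * π), Kz z x * g x :=
    intervalIntegral.integral_mono_interval (by linarith) (by linarith) (by linarith)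
      (ae_of_all _ fun x => mul_nonneg (Kz_nonneg hz x) (hg0 x)) (hint2 _ _)
  rw [e]
  refine le_trans ?_ (mul_le_mul_of_nonneg_left m1 (by norm_num))
  rw [← intervalIntegral.integral_const_mul, ← intervalIntegral.integral_const_mul]
  refine intervalIntegral.integral_mono_on (by linarith) ((hint _ _).const_mul _)
    ((hint2 _ _).const_mul _) fun x hx => ?_
  rw [← mul_assoc]
  refine mul_le_mul_of_nonneg_right (Kz_lower hs hcos hl (abs_le.2 ⟨?_, ?_⟩)) (hg0 x)
  · linarith [hx.1]
  · linarith [hx.2]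

lemma movAvg_add {f g : ℝ → ℂ} (hf : f ∈ LinfT) (hg : g ∈ LinfT) (lam θ : ℝ) :
    movAvg (f + g) lam θ = movAvg f lam θ + movAvg g lam θ := by
  unfold movAvg
  simp only [Pi.add_apply]
  rw [intervalIntegral.integral_add (LinfT.intervalIntegrable hf _ _) (LinfT.intervalIntegrable hg _ _)]
  ring

lemma movAvg_smul (c : ℂ) (f : ℝ → ℂ) (lam θ : ℝ) :
    movAvg (c • f) lam θ = c * movAvg f lam θ := by
  unfold movAvg
  simp only [Pi.smul_apply, smul_eq_mul]
  rw [intervalIntegral.integral_const_mul]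
  ring

lemma movAvg_const (c : ℂ) {lam : ℝ} (hl : 0 < lam) (θ : ℝ) :
    movAvg (fun _ => c) lam θ = c := by
  unfold movAvg
  rw [intervalIntegral.integral_const]
  have hp : (π : ℂ) ≠ 0 := by exact_mod_cast Real.pi_ne_zero
  have hl' : (lam : ℂ) ≠ 0 := by exact_mod_cast hl.ne'
  rw [Complex.real_smul]
  push_cast
  field_simp
  ring

lemma movAvg_norm_le {f : ℝ → ℂ} {g : ℝ → ℝ} {lam : ℝ} (hl : 0 < lam) (θ : ℝ)
    (hg : IntervalIntegrable g volume (θ - π / lam) (θ + π / lam)) (hfg : ∀ x, ‖f x‖ ≤ g x) :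
    ‖movAvg f lam θ‖ ≤ lam / (2 * π) * ∫ x in (θ - π / lam)..(θ + π / lam), g x := by
  have hp := Real.pi_pos
  have h0 : 0 < π / lam := by positivity
  unfold movAvg
  have e : ((lam : ℂ) / (2 * π)) = ((lam / (2 * π) : ℝ) : ℂ) := by push_cast; rfl
  rw [norm_mul, e, Complex.norm_real, Real.norm_of_nonneg (by positivity)]
  refine mul_le_mul_of_nonneg_left ?_ (by positivity)
  exact intervalIntegral.norm_integral_le_of_norm_le (by linarith) (ae_of_all _ fun x _ => hfg x) hg

lemma real_avg_const (c : ℝ) {lam : ℝ} (hl : 0 < lam) (θ : ℝ) :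
    lam / (2 * π) * ∫ _x in (θ - π / lam)..(θ + π / lam), c = c := by
  rw [intervalIntegral.integral_const]
  have hp := Real.pi_ne_zero
  simp only [smul_eq_mul]
  field_simp
  ring

lemma movAvg_bound {f : ℝ → ℂ} {C lam : ℝ} (hl : 0 < lam) (θ : ℝ) (hf : ∀ x, ‖f x‖ ≤ C) :
    ‖movAvg f lam θ‖ ≤ C := by
  have := movAvg_norm_le hl θ (g := fun _ => C) intervalIntegrable_const hf
  rwa [real_avg_const _ hl] at this

lemma Kz_var {z : ℝ} (hz : |z| < 1) {p : ℝ → ℂ} (hp : p ∈ LinfT) :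
    ((∫ x in (0 : ℝ)..(2 * π), Kz z x * ‖p x - PA z p‖ ^ 2 : ℝ) : ℂ) =
      DD z p (fun x => (starRingEnd ℂ) (p x)) := by
  set a := PA z p with ha
  set pc : ℝ → ℂ := fun x => (starRingEnd ℂ) (p x) with hpc
  have hpcL : pc ∈ LinfT := LinfT.conj hp
  have h1 : ((∫ x in (0 : ℝ)..(2 * π), Kz z x * ‖p x - a‖ ^ 2 : ℝ) : ℂ) =
      PA z (((p * pc + (fun _ => -(starRingEnd ℂ) a) * p) + (fun _ => -a) * pc) +
        fun _ => a * (starRingEnd ℂ) a) := by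
    rw [← intervalIntegral.integral_ofReal]
    unfold PA
    refine intervalIntegral.integral_congr fun x _ => ?_
    simp only [Pi.add_apply, Pi.mul_apply, hpc]
    push_cast
    rw [← Complex.mul_conj', map_sub]
    ring
  have m1 := LinfT.mul hp hpcL
  have m2 := LinfT.mul (LinfT.const (-(starRingEnd ℂ) a)) hp
  have m3 := LinfT.mul (LinfT.const (-a)) hpcL
  rw [h1, PA_add hz (LinfT.add (LinfT.add m1 m2) m3) (LinfT.const _), PA_add hz (LinfT.add m1 m2) m3,
    PA_add hz m1 m2, PA_const_mul, PA_const_mul, PA_const hz]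
  unfold DD
  rw [hpc, PA_conj, ← ha]
  ring

lemma movAvg_mult {θ s : ℝ} (hs : s ^ 2 = 1) (hcos : ∀ x, s * Real.cos x = Real.cos (x - θ))
    {p q : ℝ → ℂ} (hp : p ∈ QCset) (hq : q ∈ LinfT) :
    Tendsto (fun lam : ℝ => movAvg (p * q) lam θ - movAvg p lam θ * movAvg q lam θ) atTop (𝓝 0) := by
  have hpL := QCset.mem_LinfT hp
  obtain ⟨-, -, C, hC⟩ := id hq
  have hC0 : 0 ≤ C := (norm_nonneg _).trans (hC 0)
  have hr : Tendsto (fun lam : ℝ => 1 - 1 / lam) atTop (𝓝[<] 1) := by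
    refine tendsto_nhdsWithin_iff.2 ⟨?_, ?_⟩
    · have := (tendsto_const_nhds (x := (1 : ℝ))).sub (tendsto_inv_atTop_zero (𝕜 := ℝ))
      simpa [one_div] using this
    · filter_upwards [eventually_gt_atTop 0] with lam hlam
      have : 0 < 1 / lam := by positivity
      simp only [Set.mem_Iio]; linarith
  have hV := (DD_QC hs hcos hp).comp hr
  rw [Metric.tendsto_nhds] at hV ⊢
  intro ε hε
  set e := ε / (2 * C + 1) / 2 with he
  have he0 : 0 < e := by positivity
  filter_upwards [hV (e ^ 2 / 11) (by positivity), eventually_ge_atTop 2] with lam hlam hl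
  have hl0 : 0 < lam := by linarith
  have ht0 : 0 < 1 / lam := by positivity
  have ht2 : 1 / lam ≤ 1 / 2 := one_div_le_one_div_of_le two_pos hl
  have hs' : |s| = 1 := (pow_eq_one_iff_of_nonneg (abs_nonneg s) two_ne_zero).1 (by rw [sq_abs, hs])
  have hz : |s * (1 - 1 / lam)| < 1 := by
    rw [abs_mul, hs', one_mul]; exact abs_lt.2 ⟨by linarith, by linarith⟩
  rw [dist_zero_right] at hlam ⊢
  simp only [Function.comp_apply] at hlam
  rw [← Kz_var hz hpL, Complex.norm_real] at hlam
  set a := PA (s * (1 - 1 / lam)) p with ha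
  have hvar := (le_abs_self _).trans_lt hlam
  set u : ℝ → ℂ := p + fun _ => -a with hu
  have huL : u ∈ LinfT := LinfT.add hpL (LinfT.const _)
  obtain ⟨hup, hum, B, hB⟩ := id huL
  have hux : ∀ x, p x - a = u x := fun x => by simp [hu, sub_eq_add_neg]
  simp only [hux] at hvar
  have hav := avg_le_Kz hs hcos hl (g := fun x => ‖u x‖ ^ 2) (fun x => by positivity)
    (fun x => by simp only [hup x]) (hum.norm.pow_const 2)
    ⟨B ^ 2, fun x => pow_le_pow_left₀ (norm_nonneg _) (hB x) 2⟩
  have hav2 : lam / (2 * π) * ∫ x in (θ - π / lam)..(θ + π / lam), ‖u x‖ ^ 2 ≤ e ^ 2 := by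
    linarith
  have hp0 := Real.pi_pos
  have hpl0 : 0 < π / lam := by positivity
  have hi1 : ∀ a b, IntervalIntegrable (fun x => ‖u x‖) volume a b := fun a b =>
    (LinfT.intervalIntegrable huL a b).norm
  have hi2 : ∀ a b, IntervalIntegrable (fun x => ‖u x‖ ^ 2) volume a b := fun a b => by
    have := (LinfT.intervalIntegrable (LinfT.mul huL huL) a b).norm
    simpa [sq] using this
  have hav1 : lam / (2 * π) * ∫ x in (θ - π / lam)..(θ + π / lam), ‖u x‖ ≤ e := by
    have hmono : ∫ x in (θ - π / lam)..(θ + π / lam), ‖u x‖ ≤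
        ∫ x in (θ - π / lam)..(θ + π / lam), (e / 2 + (1 / (2 * e)) * ‖u x‖ ^ 2) := by
      refine intervalIntegral.integral_mono_on (by linarith) (hi1 _ _)
        (intervalIntegrable_const.add ((hi2 _ _).const_mul _)) fun x _ => ?_
      have : e / 2 + 1 / (2 * e) * ‖u x‖ ^ 2 - ‖u x‖ = (1 / (2 * e)) * (‖u x‖ - e) ^ 2 := by
        field_simp; ring
      have h2 : 0 ≤ (1 / (2 * e)) * (‖u x‖ - e) ^ 2 := by positivity
      linarith
    rw [intervalIntegral.integral_add intervalIntegrable_const ((hi2 _ _).const_mul _),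
      intervalIntegral.integral_const_mul] at hmono
    have h3 := mul_le_mul_of_nonneg_left hmono (by positivity : 0 ≤ lam / (2 * π))
    rw [mul_add, real_avg_const _ hl0] at h3
    have h4 := mul_le_mul_of_nonneg_left hav2 (by positivity : 0 ≤ 1 / (2 * e))
    have h5 : 1 / (2 * e) * e ^ 2 = e / 2 := by field_simp
    rw [h5] at h4
    linarith
  have hpu : p = u + fun _ => a := by ext x; simp [hu]
  have hpq : p * q = u * q + a • q := by ext x; simp [hu, add_mul]
  have haL : a • q ∈ LinfT := LinfT.mul (LinfT.const a) hq
  have E : movAvg (p * q) lam θ - movAvg p lam θ * movAvg q lam θ =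
      movAvg (u * q) lam θ - movAvg u lam θ * movAvg q lam θ := by
    rw [hpq, movAvg_add (LinfT.mul huL hq) haL, movAvg_smul]
    conv_lhs => rw [hpu]
    rw [movAvg_add huL (LinfT.const _), movAvg_const _ hl0]
    ring
  rw [E]
  have n1 : ‖movAvg (u * q) lam θ‖ ≤ C * e := by
    have := movAvg_norm_le hl0 θ (f := u * q) (g := fun x => C * ‖u x‖) ((hi1 _ _).const_mul _)
      (fun x => by
        simp only [Pi.mul_apply, norm_mul]
        rw [mul_comm]
        exact mul_le_mul_of_nonneg_right (hC x) (norm_nonneg _))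
    rw [intervalIntegral.integral_const_mul] at this
    have h := mul_le_mul_of_nonneg_left hav1 hC0
    linarith
  have n2 : ‖movAvg u lam θ‖ ≤ e := (movAvg_norm_le hl0 θ (hi1 _ _) (fun x => le_rfl)).trans hav1
  have n3 : ‖movAvg q lam θ‖ ≤ C := movAvg_bound hl0 θ hC
  have n4 := mul_le_mul n2 n3 (norm_nonneg _) he0.le
  refine (norm_sub_le _ _).trans_lt ?_
  rw [norm_mul]
  have : (2 * C + 1) * e = ε / 2 := by rw [he]; field_simp
  nlinarith

lemma fourierCoef_flip {f : ℝ → ℂ} (hf : Function.Periodic f (2 * π)) (n : ℤ) :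
    fourierCoef (flipF f) n = fourierCoef f (-n) := by
  unfold fourierCoef flipF
  congr 1
  have e1 : ∀ x : ℝ, f (-x) * Complex.exp (-(Complex.I * n * x)) =
      (fun y : ℝ => f y * Complex.exp (-(Complex.I * (-n : ℤ) * y))) (-x) := by
    intro x; simp
  simp only [e1]
  rw [intervalIntegral.integral_comp_neg (fun y : ℝ => f y * Complex.exp (-(Complex.I * (-n : ℤ) * y)))]
  have hper : Function.Periodic (fun y : ℝ => f y * Complex.exp (-(Complex.I * (-n : ℤ) * y))) (2 * π) := by
    intro y
    simp only [hf y]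
    congr 1
    rw [Complex.exp_eq_exp_iff_exists_int]
    exact ⟨n, by push_cast; ring⟩
  have := hper.intervalIntegral_add_eq (-(2 * π)) 0
  simpa using this

lemma LinfT.flip {f : ℝ → ℂ} (hf : f ∈ LinfT) : flipF f ∈ LinfT := by
  obtain ⟨hp, hm, C, hC⟩ := hf
  refine ⟨fun x => ?_, hm.comp measurable_neg, C, fun x => hC _⟩
  unfold flipF
  rw [neg_add, ← sub_eq_add_neg, hp.sub_eq]

lemma CtsT.flip {f : ℝ → ℂ} (hf : f ∈ CtsT) : flipF f ∈ CtsT := by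
  obtain ⟨hp, hc⟩ := hf
  refine ⟨fun x => ?_, hc.comp continuous_neg⟩
  unfold flipF
  rw [neg_add, ← sub_eq_add_neg, hp.sub_eq]

lemma QCset.flip {f : ℝ → ℂ} (hf : f ∈ QCset) : flipF f ∈ QCset := by
  obtain ⟨⟨c1, hc1, h1, hh1, e1⟩, ⟨c2, hc2, h2, hh2, e2⟩⟩ := hf
  refine ⟨⟨flipF c2, CtsT.flip hc2, flipF h2, ⟨LinfT.flip hh2.1, fun n hn => ?_⟩, ?_⟩,
    ⟨flipF c1, CtsT.flip hc1, flipF h1, ⟨LinfT.flip hh1.1, fun n hn => ?_⟩, ?_⟩⟩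
  · rw [fourierCoef_flip hh2.1.1]; exact hh2.2 _ (by omega)
  · rw [e2]; rfl
  · rw [fourierCoef_flip hh1.1.1]; exact hh1.2 _ (by omega)
  · rw [e1]; rfl

lemma fourierCoef_add {f g : ℝ → ℂ} (hf : f ∈ LinfT) (hg : g ∈ LinfT) (n : ℤ) :
    fourierCoef (f + g) n = fourierCoef f n + fourierCoef g n := by
  have hi : ∀ u ∈ LinfT, IntervalIntegrable
      (fun x : ℝ => u x * Complex.exp (-(Complex.I * n * x))) volume 0 (2 * π) := fun u hu =>
    (LinfT.intervalIntegrable hu _ _).mul_continuousOn (by fun_prop)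
  unfold fourierCoef
  rw [← mul_add, ← intervalIntegral.integral_add (hi f hf) (hi g hg)]
  simp only [Pi.add_apply, add_mul]

lemma fourierCoef_smul (c : ℂ) (f : ℝ → ℂ) (n : ℤ) :
    fourierCoef (c • f) n = c * fourierCoef f n := by
  unfold fourierCoef
  simp only [Pi.smul_apply, smul_eq_mul, mul_assoc]
  rw [intervalIntegral.integral_const_mul]
  ring

lemma CtsT.add {f g : ℝ → ℂ} (hf : f ∈ CtsT) (hg : g ∈ CtsT) : f + g ∈ CtsT :=
  ⟨hf.1.add hg.1, hf.2.add hg.2⟩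

lemma CtsT.smul (c : ℂ) {f : ℝ → ℂ} (hf : f ∈ CtsT) : c • f ∈ CtsT :=
  ⟨fun x => by simp [hf.1 x], hf.2.const_smul c⟩

lemma LinfT.smul (c : ℂ) {f : ℝ → ℂ} (hf : f ∈ LinfT) : c • f ∈ LinfT :=
  LinfT.mul (LinfT.const c) hf

lemma QCset.add {f g : ℝ → ℂ} (hf : f ∈ QCset) (hg : g ∈ QCset) : f + g ∈ QCset := by
  obtain ⟨⟨c1, hc1, h1, hh1, e1⟩, ⟨c2, hc2, h2, hh2, e2⟩⟩ := hf
  obtain ⟨⟨d1, hd1, k1, hk1, e3⟩, ⟨d2, hd2, k2, hk2, e4⟩⟩ := hg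
  refine ⟨⟨c1 + d1, CtsT.add hc1 hd1, h1 + k1, ⟨LinfT.add hh1.1 hk1.1, fun n hn => ?_⟩, ?_⟩,
    ⟨c2 + d2, CtsT.add hc2 hd2, h2 + k2, ⟨LinfT.add hh2.1 hk2.1, fun n hn => ?_⟩, ?_⟩⟩
  · rw [fourierCoef_add hh1.1 hk1.1, hh1.2 n hn, hk1.2 n hn, add_zero]
  · rw [e1, e3]; abel
  · rw [fourierCoef_add hh2.1 hk2.1, hh2.2 n hn, hk2.2 n hn, add_zero]
  · rw [e2, e4]; abel

lemma QCset.smul (c : ℂ) {f : ℝ → ℂ} (hf : f ∈ QCset) : c • f ∈ QCset := by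
  obtain ⟨⟨c1, hc1, h1, hh1, e1⟩, ⟨c2, hc2, h2, hh2, e2⟩⟩ := hf
  refine ⟨⟨c • c1, CtsT.smul c hc1, c • h1, ⟨LinfT.smul c hh1.1, fun n hn => ?_⟩, ?_⟩,
    ⟨c • c2, CtsT.smul c hc2, c • h2, ⟨LinfT.smul c hh2.1, fun n hn => ?_⟩, ?_⟩⟩
  · rw [fourierCoef_smul, hh1.2 n hn, mul_zero]
  · rw [e1, smul_add]
  · rw [fourierCoef_smul, hh2.2 n hn, mul_zero]
  · rw [e2, smul_add]

lemma CtsT.mem_QC {f : ℝ → ℂ} (hf : f ∈ CtsT) : f ∈ QCset := by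
  have h0 : (0 : ℝ → ℂ) ∈ LinfT := LinfT.const 0
  have h1 : ∀ n, fourierCoef (0 : ℝ → ℂ) n = 0 := by intro n; simp [fourierCoef]
  exact ⟨⟨f, hf, 0, ⟨h0, fun n _ => h1 n⟩, by simp⟩, ⟨f, hf, 0, ⟨h0, fun n _ => h1 n⟩, by simp⟩⟩

/-- Even part. -/
def evPart (f : ℝ → ℂ) : ℝ → ℂ := (1 / 2 : ℂ) • (f + flipF f)

lemma evPart_mem {f : ℝ → ℂ} (hf : f ∈ QCset) : evPart f ∈ tQCset := by
  refine ⟨QCset.smul _ (QCset.add hf (QCset.flip hf)), ?_⟩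
  ext x
  simp [evPart, flipF, add_comm]

lemma movAvg_flip {f : ℝ → ℂ} (hf : Function.Periodic f (2 * π)) {θ : ℝ} (hθ : θ = 0 ∨ θ = π)
    (lam : ℝ) : movAvg (flipF f) lam θ = movAvg f lam θ := by
  have h : ∀ x, flipF f x = f (2 * θ - x) := by
    intro x
    unfold flipF
    rcases hθ with rfl | rfl
    · simp
    · rw [show 2 * π - x = -x + 2 * π by ring, hf]
  unfold movAvg
  simp only [h]
  rw [intervalIntegral.integral_comp_sub_left]
  congr 2 <;> ring

lemma movAvg_evPart {f : ℝ → ℂ} (hf : f ∈ LinfT) {θ : ℝ} (hθ : θ = 0 ∨ θ = π)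
    (lam : ℝ) : movAvg (evPart f) lam θ = movAvg f lam θ := by
  unfold evPart
  rw [movAvg_smul, movAvg_add hf (LinfT.flip hf), movAvg_flip hf.1 hθ]
  ring

/-- The cosine as a complex valued function. -/
def cosC : ℝ → ℂ := fun x => (Real.cos x : ℂ)

lemma cosC_cts : cosC ∈ CtsT :=
  ⟨fun x => by simp only [cosC, Real.cos_add_two_pi], by unfold cosC; fun_prop⟩

lemma cosC_mem : cosC ∈ tQCset :=
  ⟨CtsT.mem_QC cosC_cts, by ext x; simp [cosC, flipF]⟩

lemma cosC_sq_mem : cosC * cosC ∈ tQCset :=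
  ⟨CtsT.mem_QC ⟨cosC_cts.1.mul cosC_cts.1, cosC_cts.2.mul cosC_cts.2⟩, by ext x; simp [cosC, flipF]⟩

lemma movAvg_contOn {f : ℝ → ℂ} (hf : Continuous f) (θ : ℝ) :
    ContinuousOn (fun lam => movAvg f lam θ) (Set.Ici 1) := by
  have hF : Continuous (fun b => ∫ x in (0 : ℝ)..b, f x) :=
    intervalIntegral.continuous_primitive (fun a b => hf.intervalIntegrable a b) 0
  have e : (fun lam => movAvg f lam θ) = fun lam : ℝ => ((lam : ℂ) / (2 * π)) *
      ((∫ x in (0 : ℝ)..(θ + π / lam), f x) - ∫ x in (0 : ℝ)..(θ - π / lam), f x) := by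
    ext lam
    unfold movAvg
    rw [intervalIntegral.integral_interval_sub_left (hf.intervalIntegrable _ _) (hf.intervalIntegrable _ _)]
  rw [e]
  have hdiv : ContinuousOn (fun lam : ℝ => π / lam) (Set.Ici 1) :=
    continuousOn_const.div continuousOn_id fun x hx => by
      have : (1 : ℝ) ≤ x := hx
      exact (by linarith : x ≠ 0)
  refine ContinuousOn.mul (by fun_prop) (ContinuousOn.sub ?_ ?_)
  · exact hF.comp_continuousOn (continuousOn_const.add hdiv)
  · exact hF.comp_continuousOn (continuousOn_const.sub hdiv)

lemma movAvg_cos_ne {θ s : ℝ} (hs : s ^ 2 = 1) (hcos : ∀ x, s * Real.cos x = Real.cos (x - θ))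
    {lam : ℝ} (hl : 1 ≤ lam) :
    movAvg (cosC * cosC) lam θ - movAvg cosC lam θ ^ 2 ≠ 0 := by
  have hl0 : 0 < lam := by linarith
  have hp := Real.pi_pos
  have hpl0 : 0 < π / lam := by positivity
  have hpl : π / lam ≤ π := div_le_self hp.le hl
  have hR : ∀ g : ℝ → ℝ, movAvg (fun x => (g x : ℂ)) lam θ =
      ((lam / (2 * π) * ∫ x in (θ - π / lam)..(θ + π / lam), g x : ℝ) : ℂ) := by
    intro g; unfold movAvg; rw [intervalIntegral.integral_ofReal]; push_cast; rfl
  have e2 : cosC * cosC = fun x => ((Real.cos x ^ 2 : ℝ) : ℂ) := by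
    ext x; simp [cosC, sq]
  intro h
  rw [e2, hR, show cosC = fun x => (Real.cos x : ℂ) from rfl, hR] at h
  set m := lam / (2 * π) * ∫ x in (θ - π / lam)..(θ + π / lam), Real.cos x with hm
  have h' : lam / (2 * π) * (∫ x in (θ - π / lam)..(θ + π / lam), Real.cos x ^ 2) - m ^ 2 = 0 := by
    exact_mod_cast h
  have hpos : 0 < ∫ x in (θ - π / lam)..(θ + π / lam), (Real.cos x - m) ^ 2 := by
    refine intervalIntegral.integral_pos (by linarith) (by fun_prop) (fun x _ => sq_nonneg _) ?_
    by_contra hcon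
    push Not at hcon
    have k1 := hcon θ ⟨by linarith, by linarith⟩
    have k2 := hcon (θ + π / lam) ⟨by linarith, le_rfl⟩
    have k1' : Real.cos θ - m = 0 := pow_eq_zero_iff two_ne_zero |>.1 (le_antisymm k1 (sq_nonneg _))
    have k2' : Real.cos (θ + π / lam) - m = 0 :=
      pow_eq_zero_iff two_ne_zero |>.1 (le_antisymm k2 (sq_nonneg _))
    have q1 := hcos θ
    have q2 := hcos (θ + π / lam)
    rw [sub_self, Real.cos_zero] at q1
    rw [add_sub_cancel_left] at q2
    have k3 : Real.cos θ = Real.cos (θ + π / lam) := by linarith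
    rw [← k3, q1] at q2
    have := Real.cos_lt_cos_of_nonneg_of_le_pi le_rfl hpl hpl0
    rw [Real.cos_zero] at this
    linarith
  have hexp : ∫ x in (θ - π / lam)..(θ + π / lam), (Real.cos x - m) ^ 2 =
      ((∫ x in (θ - π / lam)..(θ + π / lam), Real.cos x ^ 2) -
      2 * m * ∫ x in (θ - π / lam)..(θ + π / lam), Real.cos x) +
      ∫ _x in (θ - π / lam)..(θ + π / lam), m ^ 2 := by
    rw [← intervalIntegral.integral_const_mul, ← intervalIntegral.integral_sub, ← intervalIntegral.integral_add]
    · refine intervalIntegral.integral_congr fun x _ => ?_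
      ring
    all_goals exact Continuous.intervalIntegrable (by fun_prop) _ _
  have hc : lam / (2 * π) * ∫ _x in (θ - π / lam)..(θ + π / lam), m ^ 2 = m ^ 2 := real_avg_const _ hl0 θ
  have hfin : lam / (2 * π) * ∫ x in (θ - π / lam)..(θ + π / lam), (Real.cos x - m) ^ 2 = 0 := by
    rw [hexp, mul_add, hc]
    linear_combination h' + 2 * m * hm
  have : 0 < lam / (2 * π) * ∫ x in (θ - π / lam)..(θ + π / lam), (Real.cos x - m) ^ 2 :=
    mul_pos (by positivity) hpos
  linarith

lemma InM0.evPart_eq {θ : ℝ} (hθ : θ = 0 ∨ θ = π) {ξ : (ℝ → ℂ) → ℂ} (h : InM0 QCset θ ξ)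
    {q : ℝ → ℂ} (hq : q ∈ QCset) : ξ q = ξ (evPart q) := by
  rw [← sub_eq_zero, ← norm_le_zero_iff]
  refine le_of_forall_pos_le_add fun ε hε => ?_
  obtain ⟨lam, -, hlam⟩ := h.2 [q, evPart q] (by
    intro p hp
    simp only [List.mem_cons, List.not_mem_nil, or_false] at hp
    rcases hp with rfl | rfl
    · exact hq
    · exact (evPart_mem hq).1) (ε / 2) (by positivity)
  have h1 := hlam q (by simp)
  have h2 := hlam (evPart q) (by simp)
  rw [movAvg_evPart (QCset.mem_LinfT hq) hθ] at h2
  have e : ξ q - ξ (evPart q) = (ξ q - movAvg q lam θ) - (ξ (evPart q) - movAvg q lam θ) := by ring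
  rw [e]
  refine (norm_sub_le _ _).trans ?_
  linarith

lemma exists_net {θ : ℝ} {η : (ℝ → ℂ) → ℂ} (h : InM0 tQCset θ η) :
    ∃ L : Finset tQCset × ℕ → ℝ, (∀ i, 1 ≤ L i) ∧
      ∀ q ∈ tQCset, Tendsto (fun i => movAvg q (L i) θ) atTop (𝓝 (η q)) := by
  have hch : ∀ i : Finset tQCset × ℕ, ∃ lam : ℝ, 1 ≤ lam ∧
      ∀ q ∈ i.1.toList.map Subtype.val, ‖η q - movAvg q lam θ‖ < 1 / ((i.2 : ℝ) + 1) := by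
    intro i
    refine h.2 _ ?_ _ (by positivity)
    intro q hq
    obtain ⟨a, -, rfl⟩ := List.mem_map.1 hq
    exact a.2
  choose L hL1 hL using hch
  refine ⟨L, hL1, fun q hq => ?_⟩
  rw [Metric.tendsto_nhds]
  intro ε hε
  obtain ⟨N, hN⟩ := exists_nat_one_div_lt hε
  filter_upwards [eventually_ge_atTop (({⟨q, hq⟩} : Finset tQCset), N)] with i hi
  have h1 := hL i q (List.mem_map.2 ⟨⟨q, hq⟩, by
    rw [Finset.mem_toList]; exact hi.1 (Finset.mem_singleton_self _), rfl⟩)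
  rw [dist_comm, dist_eq_norm]
  refine h1.trans (lt_of_le_of_lt ?_ hN)
  have : (N : ℝ) ≤ i.2 := by exact_mod_cast hi.2
  exact one_div_le_one_div_of_le (by positivity) (by linarith)


/-- For `τ = 1` (angle `0`) or `τ = -1` (angle `π`), the restriction map `Ψ : ξ ↦ ξ|_{Q̃C}`
is a bijection from `M_τ^0(QC)` onto `M_τ^0(Q̃C)`: it maps `M_τ^0(QC)` into `M_τ^0(Q̃C)`,
it is injective (characters in `M_τ^0(QC)` agreeing on `Q̃C` agree on `QC`), and it is
surjective (every `η ∈ M_τ^0(Q̃C)` is the restriction of some `ξ ∈ M_τ^0(QC)`). -/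
theorem Psi_bijection_M0 (θ : ℝ) (hθ : θ = 0 ∨ θ = π) :
    (∀ ξ, InM0 QCset θ ξ → InM0 tQCset θ ξ) ∧
    (∀ ξ₁ ξ₂, InM0 QCset θ ξ₁ → InM0 QCset θ ξ₂ →
      (∀ q ∈ tQCset, ξ₁ q = ξ₂ q) → ∀ q ∈ QCset, ξ₁ q = ξ₂ q) ∧
    (∀ η, InM0 tQCset θ η → ∃ ξ, InM0 QCset θ ξ ∧ ∀ q ∈ tQCset, ξ q = η q) := by
  refine ⟨fun ξ h => ?_, fun ξ₁ ξ₂ h1 h2 h12 q hq => ?_, fun η h => ?_⟩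
  · obtain ⟨⟨a, b, c, d, e⟩, f⟩ := h
    exact ⟨⟨fun p hp q hq => a p hp.1 q hq.1, fun p hp q hq => b p hp.1 q hq.1,
      fun c' q hq => c c' q hq.1, d, fun q hq => e q hq.1⟩, fun qs hqs => f qs fun q hq => (hqs q hq).1⟩
  · rw [InM0.evPart_eq hθ h1 hq, InM0.evPart_eq hθ h2 hq, h12 _ (evPart_mem hq)]
  · obtain ⟨s, hs, hcos⟩ : ∃ s : ℝ, s ^ 2 = 1 ∧ ∀ x, s * Real.cos x = Real.cos (x - θ) := by
      rcases hθ with rfl | rfl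
      · exact ⟨1, by norm_num, fun x => by simp⟩
      · exact ⟨-1, by norm_num, fun x => by rw [Real.cos_sub_pi]; ring⟩
    obtain ⟨L, hL1, hL⟩ := exists_net h
    classical
    have : (atTop : Filter (Finset tQCset × ℕ)).NeBot := inferInstance
    have hLtop : Tendsto L atTop atTop := by
      have hv : Tendsto (fun i => movAvg (cosC * cosC) (L i) θ - movAvg cosC (L i) θ ^ 2) atTop (𝓝 0) := by
        have := (hL _ cosC_sq_mem).sub ((hL _ cosC_mem).pow 2)
        rwa [h.1.2.1 _ cosC_mem _ cosC_mem, ← sq (η cosC), sub_self] at this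
      rw [tendsto_atTop]
      intro R
      have hcont : ContinuousOn (fun lam => ‖movAvg (cosC * cosC) lam θ - movAvg cosC lam θ ^ 2‖)
          (Set.Icc 1 (max 1 R)) :=
        (((movAvg_contOn (cosC_cts.2.mul cosC_cts.2) θ).sub
          ((movAvg_contOn cosC_cts.2 θ).pow 2)).norm).mono Set.Icc_subset_Ici_self
      obtain ⟨l0, hl0, hmin⟩ := isCompact_Icc.exists_isMinOn
        (Set.nonempty_Icc.2 (le_max_left 1 R)) hcont
      have hp0 := norm_pos_iff.2 (movAvg_cos_ne hs hcos hl0.1)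
      have hev := hv.norm
      rw [norm_zero] at hev
      filter_upwards [hev.eventually_lt_const hp0] with i hi
      by_contra hcon
      push Not at hcon
      have := isMinOn_iff.1 hmin (L i) ⟨hL1 i, hcon.le.trans (le_max_right _ _)⟩
      exact absurd hi (not_lt.2 this)
    have hLpos : ∀ i, 0 < L i := fun i => by linarith [hL1 i]
    set ξ : (ℝ → ℂ) → ℂ := fun q => limUnder atTop (fun i => movAvg q (L i) θ) with hξ
    have hlim : ∀ q ∈ QCset, Tendsto (fun i => movAvg q (L i) θ) atTop (𝓝 (ξ q)) := by
      intro q hq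
      have h1 := hL _ (evPart_mem hq)
      simp only [movAvg_evPart (QCset.mem_LinfT hq) hθ] at h1
      simp only [hξ]
      rw [h1.limUnder_eq]
      exact h1
    refine ⟨ξ, ⟨⟨?_, ?_, ?_, ?_, ?_⟩, ?_⟩, fun q hq => (hL q hq).limUnder_eq⟩
    · intro p hp q hq
      have := (hlim p hp).add (hlim q hq)
      simp only [← movAvg_add (QCset.mem_LinfT hp) (QCset.mem_LinfT hq)] at this
      exact this.limUnder_eq
    · intro p hp q hq
      have h1 := (movAvg_mult hs hcos hp (QCset.mem_LinfT hq)).comp hLtop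
      have h2 := h1.add ((hlim p hp).mul (hlim q hq))
      simp only [Function.comp_def, sub_add_cancel, zero_add] at h2
      exact h2.limUnder_eq
    · intro c q hq
      have := (hlim q hq).const_mul c
      simp only [← movAvg_smul] at this
      exact this.limUnder_eq
    · have : Tendsto (fun i => movAvg (1 : ℝ → ℂ) (L i) θ) atTop (𝓝 1) := by
        refine tendsto_const_nhds.congr fun i => ?_
        exact (movAvg_const 1 (hLpos i) θ).symm
      exact this.limUnder_eq
    · intro q hq C hC
      exact le_of_tendsto (hlim q hq).norm
        (Eventually.of_forall fun i => movAvg_bound (hLpos i) θ hC)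
    · intro qs hqs ε hε
      have hev : ∀ᶠ i in atTop, ∀ q ∈ qs, ‖ξ q - movAvg q (L i) θ‖ < ε := by
        have hfin : ∀ᶠ i in atTop, ∀ q ∈ qs.toFinset, ‖ξ q - movAvg q (L i) θ‖ < ε := by
          rw [Filter.eventually_all_finset]
          intro q hq
          have := Metric.tendsto_nhds.1 (hlim q (hqs q (List.mem_toFinset.1 hq))) ε hε
          filter_upwards [this] with i hi
          rwa [dist_comm, dist_eq_norm] at hi
        filter_upwards [hfin] with i hi q hq
        exact hi q (List.mem_toFinset.2 hq)
      obtain ⟨i, hi⟩ := hev.exists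
      exact ⟨L i, hL1 i, hi⟩
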